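/- Assume m = n. Then inf{Re z : z ∈ σ(L₁)} = inf{Re z : z ∈ σ(L₂)} if and only if the Cheeger constant α equals 0. -/

import Mathlib

open MeasureTheory
open scoped ENNReal

lemma aux_ae {X : Type*} [Countable X] [MeasurableSpace X] [MeasurableSingletonClass X]
    {n : X → ℝ} (hn_pos : ∀ x, 0 < n x) {μ : Measure X}
    (hμ : μ = Measure.sum fun x => ENNReal.ofReal (n x) • Measure.dirac x)
    {P : X → Prop} (h : ∀ᵐ x ∂μ, P x) : ∀ x, P x := by
  intro x
  rw [hμ, Measure.ae_sum_iff] at h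
  have h1 := h x
  rw [Measure.ae_ennreal_smul_measure_iff (by simpa using hn_pos x)] at h1
  simpa [ae_dirac_eq] using h1

lemma aux_int {X : Type*} [Countable X] [MeasurableSpace X] [MeasurableSingletonClass X]
    {E : Type*} [NormedAddCommGroup E] [NormedSpace ℝ E] [CompleteSpace E]
    {n : X → ℝ} (hn_pos : ∀ x, 0 < n x) {μ : Measure X}
    (hμ : μ = Measure.sum fun x => ENNReal.ofReal (n x) • Measure.dirac x)
    {F : X → E} (hF : Integrable F μ) : HasSum (fun x => n x • F x) (∫ x, F x ∂μ) := by
  subst hμ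
  have := hasSum_integral_measure hF
  simpa [integral_smul_measure, ENNReal.toReal_ofReal (hn_pos _).le] using this

lemma aux_coarea {X : Type*} [DecidableEq X] (b : X → X → ℝ)
    (n : X → ℝ) (a : ℝ)
    (ha : ∀ W : Finset X, ∑ x ∈ W, ∑ y ∈ W, b x y ≤ (1 - a) * ∑ x ∈ W, n x)
    (k : ℕ) : ∀ (W : Finset X), W.card = k → ∀ (g : X → ℝ), (∀ x ∈ W, 0 ≤ g x) →
    ∑ x ∈ W, ∑ y ∈ W, b x y * min (g x) (g y) ≤ (1 - a) * ∑ x ∈ W, n x * g x := by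
  induction k with
  | zero =>
    intro W hW g hg
    rw [Finset.card_eq_zero] at hW
    subst hW; simp
  | succ k ih =>
    intro W hW g hg
    have hne : W.Nonempty := by rw [← Finset.card_pos]; omega
    obtain ⟨x0, hx0, hmin⟩ := W.exists_min_image g hne
    have key := ih (W.erase x0) (by rw [Finset.card_erase_of_mem hx0, hW]; rfl)
      (fun x => g x - g x0) (fun x hx => sub_nonneg.2 (hmin x (Finset.mem_of_mem_erase hx)))
    have e1 : ∑ x ∈ W.erase x0, n x * (g x - g x0) = ∑ x ∈ W, n x * (g x - g x0) := by
      rw [← Finset.add_sum_erase W _ hx0]; simp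
    have e2 : ∑ x ∈ W.erase x0, ∑ y ∈ W.erase x0, b x y * min (g x - g x0) (g y - g x0)
        = ∑ x ∈ W, ∑ y ∈ W, b x y * min (g x - g x0) (g y - g x0) := by
      rw [← Finset.add_sum_erase W _ hx0]
      rw [Finset.sum_eq_zero (s := W), zero_add]
      · refine Finset.sum_congr rfl fun x hx => ?_
        rw [← Finset.add_sum_erase W _ hx0]
        have := hmin x (Finset.mem_of_mem_erase hx)
        simp [this]
      · intro y hy
        simp [hmin y hy]
    have e3 : ∑ x ∈ W, ∑ y ∈ W, b x y * min (g x - g x0) (g y - g x0) =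
        ∑ x ∈ W, ∑ y ∈ W, b x y * min (g x) (g y) - g x0 * ∑ x ∈ W, ∑ y ∈ W, b x y := by
      simp only [min_sub_sub_right, Finset.mul_sum, ← Finset.sum_sub_distrib]
      refine Finset.sum_congr rfl fun x hx => Finset.sum_congr rfl fun y hy => by ring
    have e4 : ∑ x ∈ W, n x * (g x - g x0) = ∑ x ∈ W, n x * g x - g x0 * ∑ x ∈ W, n x := by
      simp only [Finset.mul_sum, ← Finset.sum_sub_distrib]
      refine Finset.sum_congr rfl fun x hx => by ring
    rw [e2, e3, e1, e4] at key
    have := mul_le_mul_of_nonneg_left (ha W) (hg x0 hx0)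
    nlinarith

lemma aux_cheeger {X : Type*} [DecidableEq X] (b : X → X → ℝ)
    (hb_symm : ∀ x y, b x y = b y x) (hb_nonneg : ∀ x y, 0 ≤ b x y)
    (n : X → ℝ) (hbn : ∀ x (W : Finset X), ∑ y ∈ W, b x y ≤ n x) (a : ℝ) (ha0 : 0 ≤ a)
    (ha1 : a ≤ 1)
    (ha : ∀ W : Finset X, ∑ x ∈ W, ∑ y ∈ W, b x y ≤ (1 - a) * ∑ x ∈ W, n x)
    (W : Finset X) (u : X → ℝ) :
    ∑ x ∈ W, ∑ y ∈ W, b x y * (u x * u y) ≤ (1 - a ^ 2 / 2) * ∑ x ∈ W, n x * u x ^ 2 := by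
  have hM := aux_coarea b n a ha _ W rfl (fun x => u x ^ 2) (fun x _ => sq_nonneg _)
  set N := ∑ x ∈ W, n x * u x ^ 2 with hN
  have hn0 : ∀ x, 0 ≤ n x := fun x => by simpa using hbn x ∅
  have hN0 : 0 ≤ N := Finset.sum_nonneg fun x _ => mul_nonneg (hn0 x) (sq_nonneg _)
  set M := ∑ x ∈ W, ∑ y ∈ W, b x y * min (u x ^ 2) (u y ^ 2) with hMd
  have hsum : ∑ x ∈ W, ∑ y ∈ W, b x y * u x ^ 2 ≤ N := by
    refine Finset.sum_le_sum fun x _ => ?_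
    rw [← Finset.sum_mul]
    exact mul_le_mul_of_nonneg_right (hbn x W) (sq_nonneg _)
  have hsum' : ∑ x ∈ W, ∑ y ∈ W, b x y * u y ^ 2 ≤ N := by
    rw [Finset.sum_comm]
    simpa only [hb_symm] using hsum
  have hmax : ∑ x ∈ W, ∑ y ∈ W, b x y * max (u x ^ 2) (u y ^ 2) ≤ 2 * N - M := by
    have : ∑ x ∈ W, ∑ y ∈ W, b x y * max (u x ^ 2) (u y ^ 2) + M =
      ∑ x ∈ W, ∑ y ∈ W, b x y * u x ^ 2 + ∑ x ∈ W, ∑ y ∈ W, b x y * u y ^ 2 := by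
      rw [hMd]
      simp only [← Finset.sum_add_distrib, ← mul_add, max_add_min]
    linarith
  have hM0 : 0 ≤ M := Finset.sum_nonneg fun x _ => Finset.sum_nonneg fun y _ =>
    mul_nonneg (hb_nonneg _ _) (le_min (sq_nonneg _) (sq_nonneg _))
  have hCS : (∑ x ∈ W, ∑ y ∈ W, b x y * (u x * u y)) ^ 2 ≤
      M * ∑ x ∈ W, ∑ y ∈ W, b x y * max (u x ^ 2) (u y ^ 2) := by
    rw [hMd]
    simp only [← Finset.sum_product']
    refine Finset.sum_sq_le_sum_mul_sum_of_sq_le_mul _ ?_ ?_ ?_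
    · intro p _
      exact mul_nonneg (hb_nonneg _ _) (le_min (sq_nonneg _) (sq_nonneg _))
    · intro p _
      exact mul_nonneg (hb_nonneg _ _) (le_max_of_le_left (sq_nonneg _))
    · intro p _
      have := min_mul_max (u p.1 ^ 2) (u p.2 ^ 2)
      apply le_of_eq
      linear_combination -(b p.1 p.2) ^ 2 * this
  refine (le_abs_self _).trans (abs_le_of_sq_le_sq ?_ (mul_nonneg (by nlinarith) hN0))
  have h1 := mul_le_mul_of_nonneg_left hmax hM0
  have h2 : 0 ≤ a * N := mul_nonneg ha0 hN0
  have h3 : a * N ≤ N - M := by linarith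
  have h4 : (a * N) ^ 2 ≤ (N - M) ^ 2 := by gcongr
  nlinarith [sq_nonneg (a ^ 2 * N)]

open scoped Pointwise in
lemma aux_ball {A : Type*} [NormedRing A] [NormedAlgebra ℂ A] [CompleteSpace A] (a : A)
    (ha : ‖1 - a‖ ≤ 1) (hone : ‖(1 : A)‖ ≤ 1) (z : ℂ) (hz : z ∈ spectrum ℂ a) : 0 ≤ z.re := by
  have h1 : (1 : ℂ) - z ∈ spectrum ℂ (1 - a) := by
    have h0 : (1 : ℂ) - z ∈ {(1 : ℂ)} - spectrum ℂ a := Set.sub_mem_sub rfl hz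
    rwa [spectrum.singleton_sub_eq, map_one] at h0
  have h2 := spectrum.subset_closedBall_norm_mul _ h1
  rw [mem_closedBall_zero_iff] at h2
  have h4 : ‖1 - a‖ * ‖(1 : A)‖ ≤ 1 * 1 := by gcongr
  have h5 := Complex.re_le_norm (1 - z)
  simp at h5
  linarith

lemma aux_summ {X : Type*} [Countable X] [MeasurableSpace X] [MeasurableSingletonClass X]
    (b : X → X → ℝ)
    (hb_symm : ∀ x y, b x y = b y x)
    (hb_nonneg : ∀ x y, 0 ≤ b x y)
    (n : X → ℝ)
    (hn : ∀ x, HasSum (b x) (n x))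
    (hn_pos : ∀ x, 0 < n x)
    (μ : Measure X)
    (hμ : μ = Measure.sum fun x => ENNReal.ofReal (n x) • Measure.dirac x)
    (f : Lp ℂ 1 μ) :
    HasSum (fun x => n x * ‖f x‖) ‖f‖ ∧
    Summable (fun p : X × X => b p.2 p.1 * ‖f p.1‖) ∧
    Summable (fun p : X × X => (b p.2 p.1 : ℂ) * f p.1) := by
  have hf : Integrable (f : X → ℂ) μ := L1.integrable_coeFn f
  have h1 := aux_int hn_pos hμ hf.norm
  rw [← L1.norm_eq_integral_norm] at h1
  simp only [smul_eq_mul] at h1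
  have h2 : Summable (fun p : X × X => b p.2 p.1 * ‖f p.1‖) := by
    rw [summable_prod_of_nonneg (fun p => mul_nonneg (hb_nonneg _ _) (norm_nonneg _))]
    have : ∀ x, HasSum (fun y => b y x * ‖f x‖) (n x * ‖f x‖) := fun x => by
      simp only [fun y => hb_symm y x]
      exact (hn x).mul_right _
    refine ⟨fun x => (this x).summable, ?_⟩
    simp only [(this _).tsum_eq]
    exact h1.summable
  refine ⟨h1, h2, ?_⟩
  refine Summable.of_norm ?_
  convert h2 using 2 with p
  simp [abs_of_nonneg (hb_nonneg _ _)]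

lemma aux_L1_formula {X : Type*} [Countable X] [MeasurableSpace X] [MeasurableSingletonClass X]
    (b : X → X → ℝ)
    (hb_symm : ∀ x y, b x y = b y x)
    (hb_nonneg : ∀ x y, 0 ≤ b x y)
    (n : X → ℝ)
    (hn : ∀ x, HasSum (b x) (n x))
    (hn_pos : ∀ x, 0 < n x)
    (μ : Measure X)
    (hμ : μ = Measure.sum fun x => ENNReal.ofReal (n x) • Measure.dirac x)
    (f : Lp ℂ 1 μ) (x : X) :
    (n x : ℂ)⁻¹ * ∑' y : X, (b x y : ℂ) * (f x - f y) =
      f x - (n x : ℂ)⁻¹ * ∑' y : X, (b x y : ℂ) * f y := by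
  obtain ⟨-, -, h3⟩ := aux_summ b hb_symm hb_nonneg n hn hn_pos μ hμ f
  have hs : Summable fun y => (b x y : ℂ) * f y := by
    exact (h3.comp_injective (Prod.mk_left_injective x) :)
  have hs2 : HasSum (fun y => (b x y : ℂ)) (n x) := by
    exact_mod_cast Complex.hasSum_ofReal.2 (hn x)
  have hs3 := (hs2.mul_right (f x)).sub hs.hasSum
  simp only [mul_sub]
  rw [hs3.tsum_eq, mul_sub, inv_mul_cancel_left₀]
  exact_mod_cast (hn_pos x).ne'

lemma aux_L1 {X : Type*} [Countable X] [MeasurableSpace X] [MeasurableSingletonClass X]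
    (b : X → X → ℝ)
    (hb_symm : ∀ x y, b x y = b y x)
    (hb_nonneg : ∀ x y, 0 ≤ b x y)
    (n : X → ℝ)
    (hn : ∀ x, HasSum (b x) (n x))
    (hn_pos : ∀ x, 0 < n x)
    (μ : Measure X)
    (hμ : μ = Measure.sum fun x => ENNReal.ofReal (n x) • Measure.dirac x)
    (x0 : X) (L1 : Lp ℂ 1 μ →L[ℂ] Lp ℂ 1 μ)
    (hL1 : ∀ f : Lp ℂ 1 μ, ∀ᵐ x ∂μ,
      (L1 f : X → ℂ) x =
        (n x : ℂ)⁻¹ * ∑' y : X, (b x y : ℂ) * ((f : X → ℂ) x - (f : X → ℂ) y)) :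
    sInf (Complex.re '' spectrum ℂ L1) = 0 := by
  have hL : ∀ f : Lp ℂ 1 μ, ∀ x, (L1 f) x = f x - (n x : ℂ)⁻¹ * ∑' y : X, (b x y : ℂ) * f y :=
    fun f x => by
      rw [aux_ae hn_pos hμ (hL1 f) x, aux_L1_formula b hb_symm hb_nonneg n hn hn_pos μ hμ]
  have hnc : ∀ x, (n x : ℂ) ≠ 0 := fun x => by exact_mod_cast (hn_pos x).ne'
  have hμfin : ∀ x, μ {x} ≠ ∞ := fun x => by
    rw [hμ, Measure.sum_apply _ (measurableSet_singleton x), tsum_eq_single x]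
    · simp
    · intro y hy; simp [hy]
  have hcontr : ‖1 - L1‖ ≤ 1 := by
    refine ContinuousLinearMap.opNorm_le_bound _ zero_le_one fun f => ?_
    rw [one_mul]
    obtain ⟨h1, h2, h3⟩ := aux_summ b hb_symm hb_nonneg n hn hn_pos μ hμ f
    obtain ⟨h1', -, -⟩ := aux_summ b hb_symm hb_nonneg n hn hn_pos μ hμ ((1 - L1) f)
    have e : ∀ x, n x * ‖((1 - L1) f) x‖ = ‖∑' y : X, (b x y : ℂ) * f y‖ := by
      intro x
      have h4 : ((1 - L1) f) x = f x - (L1 f) x := aux_ae hn_pos hμ (Lp.coeFn_sub f (L1 f)) x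
      rw [h4, hL, sub_sub_cancel, norm_mul, norm_inv, Complex.norm_real, Real.norm_eq_abs,
        abs_of_pos (hn_pos x), mul_inv_cancel_left₀ (hn_pos x).ne']
    simp only [e] at h1'
    have h5 : ∀ x, HasSum (fun y => b y x * ‖f x‖) (n x * ‖f x‖) := fun x => by
      simp only [fun y => hb_symm y x]
      exact (hn x).mul_right _
    have h6 := h2.hasSum
    have h7 : ∑' p : X × X, b p.2 p.1 * ‖f p.1‖ = ‖f‖ := (h6.prod_fiberwise h5).unique h1
    rw [h7] at h6
    have h8 : HasSum (fun p : X × X => b p.1 p.2 * ‖f p.2‖) ‖f‖ :=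
      (Equiv.prodComm X X).hasSum_iff.2 h6
    have h9 := h8.prod_fiberwise (fun x => (h8.summable.prod_factor x).hasSum)
    refine hasSum_le (fun x => ?_) h1' h9
    have h10 : ∀ y, ‖(b x y : ℂ) * f y‖ = b x y * ‖f y‖ := fun y => by
      simp [abs_of_nonneg (hb_nonneg _ _)]
    have := norm_tsum_le_tsum_norm (f := fun y => (b x y : ℂ) * f y)
      (by simp only [h10]; exact h8.summable.prod_factor x)
    simpa only [h10] using this
  have hzero : (0 : ℂ) ∈ spectrum ℂ L1 := by
    rw [spectrum.zero_mem_iff]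
    rintro ⟨U, hU⟩
    have hint : ∀ f : Lp ℂ 1 μ, ∫ x, (L1 f) x ∂μ = 0 := by
      intro f
      obtain ⟨h1, h2, h3⟩ := aux_summ b hb_symm hb_nonneg n hn hn_pos μ hμ f
      have hi := aux_int hn_pos hμ (MeasureTheory.L1.integrable_coeFn (L1 f))
      have hi2 := aux_int hn_pos hμ (MeasureTheory.L1.integrable_coeFn f)
      have h5 : ∀ x, HasSum (fun y => (b y x : ℂ) * f x) (n x • f x) := fun x => by
        simp only [fun y => hb_symm y x, Complex.real_smul]
        exact (Complex.hasSum_ofReal.2 (hn x)).mul_right _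
      have h6 := h3.hasSum
      have h7 := (h6.prod_fiberwise h5).unique hi2
      rw [h7] at h6
      have h8 : HasSum (fun p : X × X => (b p.1 p.2 : ℂ) * f p.2) (∫ x, f x ∂μ) :=
        (Equiv.prodComm X X).hasSum_iff.2 h6
      have h9 := h8.prod_fiberwise (fun x => (h8.summable.prod_factor x).hasSum)
      have h10 := hi2.sub h9
      rw [sub_self] at h10
      refine hi.unique ?_
      convert h10 using 2 with x
      rw [hL, smul_sub]
      congr 1
      rw [Complex.real_smul, mul_inv_cancel_left₀ (hnc x)]
    set g : Lp ℂ 1 μ := indicatorConstLp 1 (measurableSet_singleton x0) (hμfin x0) (1 : ℂ)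
    have hg := hint ((↑U⁻¹ : Lp ℂ 1 μ →L[ℂ] Lp ℂ 1 μ) g)
    rw [← hU, ← mul_apply_eq_comp, Units.mul_inv] at hg
    simp only [one_apply_eq_self] at hg
    have hsg := aux_int hn_pos hμ (MeasureTheory.L1.integrable_coeFn g)
    rw [hg] at hsg
    have hgx : ∀ x, g x = Set.indicator {x0} (fun _ => (1 : ℂ)) x :=
      aux_ae hn_pos hμ indicatorConstLp_coeFn
    have := hsg.unique (hasSum_single x0 (fun y hy => by rw [hgx]; simp [hy]))
    rw [hgx] at this
    simp at this
    exact hnc x0 this.symm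
  have hnn : ∀ z ∈ spectrum ℂ L1, 0 ≤ z.re := by
    intro z hz
    exact aux_ball L1 hcontr ContinuousLinearMap.norm_id_le z hz
  apply le_antisymm
  · exact csInf_le ⟨0, by rintro _ ⟨z, hz, rfl⟩; exact hnn z hz⟩ ⟨0, hzero, rfl⟩
  · exact le_csInf ⟨0, 0, hzero, rfl⟩ (by rintro _ ⟨z, hz, rfl⟩; exact hnn z hz)
lemma aux_norm2 {X : Type*} [Countable X] [MeasurableSpace X] [MeasurableSingletonClass X]
    (n : X → ℝ)
    (hn_pos : ∀ x, 0 < n x)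
    (μ : Measure X)
    (hμ : μ = Measure.sum fun x => ENNReal.ofReal (n x) • Measure.dirac x)
    (f : Lp ℂ 2 μ) : HasSum (fun x => n x * ‖f x‖ ^ 2) (‖f‖ ^ 2) := by
  have h1 := aux_int hn_pos hμ (MeasureTheory.L2.integrable_inner (𝕜 := ℂ) f f)
  rw [← MeasureTheory.L2.inner_def] at h1
  have h2 := Complex.hasSum_re h1
  have h3 : (inner ℂ f f).re = ‖f‖ ^ 2 := by
    rw [inner_self_eq_norm_sq_to_K]; norm_cast
  rw [h3] at h2
  convert h2 using 2 with x
  rw [inner_self_eq_norm_sq_to_K, Complex.smul_re, smul_eq_mul]; norm_cast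

lemma aux_fin {X : Type*} [Countable X] [MeasurableSpace X] [MeasurableSingletonClass X]
    (n : X → ℝ)
    (hn_pos : ∀ x, 0 < n x)
    (μ : Measure X)
    (hμ : μ = Measure.sum fun x => ENNReal.ofReal (n x) • Measure.dirac x)
    (x : X) : μ {x} ≠ ∞ := by
  rw [hμ, Measure.sum_apply _ (measurableSet_singleton x), tsum_eq_single x]
  · simp
  · intro y hy; simp [hy]

lemma aux_L2_formula {X : Type*} [Countable X] [MeasurableSpace X] [MeasurableSingletonClass X]
    (b : X → X → ℝ)
    (n : X → ℝ)
    (hn : ∀ x, HasSum (b x) (n x))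
    (hn_pos : ∀ x, 0 < n x)
    (μ : Measure X)
    (hμ : μ = Measure.sum fun x => ENNReal.ofReal (n x) • Measure.dirac x)
    (L2 : Lp ℂ 2 μ →L[ℂ] Lp ℂ 2 μ)
    (hL2 : ∀ f : Lp ℂ 2 μ, ∀ᵐ x ∂μ,
      (L2 f : X → ℂ) x =
        (n x : ℂ)⁻¹ * ∑' y : X, (b x y : ℂ) * ((f : X → ℂ) x - (f : X → ℂ) y))
    (f : Lp ℂ 2 μ) (W : Finset X) (hW : ∀ x, x ∉ W → f x = 0) (x : X) :
    (L2 f) x = f x - (n x : ℂ)⁻¹ * ∑ y ∈ W, (b x y : ℂ) * f y := by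
  rw [aux_ae hn_pos hμ (hL2 f) x]
  have hs : HasSum (fun y => (b x y : ℂ) * f y) (∑ y ∈ W, (b x y : ℂ) * f y) :=
    hasSum_sum_of_ne_finset_zero fun y hy => by simp [hW y hy]
  have hs2 : HasSum (fun y => (b x y : ℂ)) (n x) := by
    exact_mod_cast Complex.hasSum_ofReal.2 (hn x)
  have hs3 := (hs2.mul_right (f x)).sub hs
  simp only [mul_sub]
  rw [hs3.tsum_eq, mul_sub, inv_mul_cancel_left₀]
  exact_mod_cast (hn_pos x).ne'

lemma aux_quad_fin {X : Type*} [Countable X] [MeasurableSpace X] [MeasurableSingletonClass X]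
    (b : X → X → ℝ)
    (hb_nonneg : ∀ x y, 0 ≤ b x y)
    (n : X → ℝ)
    (hn : ∀ x, HasSum (b x) (n x))
    (hn_pos : ∀ x, 0 < n x)
    (μ : Measure X)
    (hμ : μ = Measure.sum fun x => ENNReal.ofReal (n x) • Measure.dirac x)
    (L2 : Lp ℂ 2 μ →L[ℂ] Lp ℂ 2 μ)
    (hL2 : ∀ f : Lp ℂ 2 μ, ∀ᵐ x ∂μ,
      (L2 f : X → ℂ) x =
        (n x : ℂ)⁻¹ * ∑' y : X, (b x y : ℂ) * ((f : X → ℂ) x - (f : X → ℂ) y))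
    (c : ℝ)
    (hc : ∀ (W : Finset X) (u : X → ℝ), ∑ x ∈ W, ∑ y ∈ W, b x y * (u x * u y) ≤
      (1 - c) * ∑ x ∈ W, n x * u x ^ 2)
    (f : Lp ℂ 2 μ) (W : Finset X) (hW : ∀ x, x ∉ W → f x = 0) :
    c * ‖f‖ ^ 2 ≤ (inner ℂ (L2 f) f).re := by
  have h1 := Complex.hasSum_re (aux_int hn_pos hμ (MeasureTheory.L2.integrable_inner (𝕜 := ℂ) (L2 f) f))
  rw [← MeasureTheory.L2.inner_def] at h1
  have h2 := h1.unique (hasSum_sum_of_ne_finset_zero (s := W) fun y hy => by simp [hW y hy])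
  have h3 := (aux_norm2 n hn_pos μ hμ f).unique
    (hasSum_sum_of_ne_finset_zero (s := W) fun y hy => by simp [hW y hy])
  rw [h2, h3]
  have h4 := hc W (fun x => ‖f x‖)
  have h5 : ∑ x ∈ W, n x * ‖f x‖ ^ 2 - ∑ x ∈ W, ∑ y ∈ W, b x y * (‖f x‖ * ‖f y‖) ≤
      ∑ x ∈ W, (n x • inner ℂ ((L2 f) x) (f x)).re := by
    rw [← Finset.sum_sub_distrib]
    refine Finset.sum_le_sum fun x hx => ?_
    rw [aux_L2_formula b n hn hn_pos μ hμ L2 hL2 f W hW x, inner_sub_left, Complex.smul_re,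
      Complex.sub_re, smul_eq_mul, mul_sub]
    have e1 : (inner ℂ (f x) (f x)).re = ‖f x‖ ^ 2 := by
      rw [inner_self_eq_norm_sq_to_K]; norm_cast
    rw [e1]
    have e2 : n x * (inner ℂ ((n x : ℂ)⁻¹ * ∑ y ∈ W, (b x y : ℂ) * f y) (f x)).re =
        ∑ y ∈ W, b x y * (inner ℂ (f y) (f x)).re := by
      rw [← smul_eq_mul (n x : ℂ)⁻¹, inner_smul_left, sum_inner]
      have e3 : ∀ y, inner ℂ ((b x y : ℂ) * f y) (f x) = (b x y : ℂ) * inner ℂ (f y) (f x) := by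
        intro y
        rw [← smul_eq_mul, inner_smul_left, Complex.conj_ofReal]
      simp only [e3, Complex.conj_ofReal, map_inv₀]
      rw [← Complex.ofReal_inv, Complex.re_ofReal_mul, mul_inv_cancel_left₀ (hn_pos x).ne',
        Complex.re_sum]
      simp only [Complex.re_ofReal_mul]
    rw [e2]
    gcongr with y hy
    · exact hb_nonneg _ _
    · rw [mul_comm]
      exact (Complex.re_le_norm _).trans (norm_inner_le_norm _ _)
  linarith

lemma aux_quad {X : Type*} [Countable X] [MeasurableSpace X] [MeasurableSingletonClass X]
    [DecidableEq X]
    (b : X → X → ℝ)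
    (hb_nonneg : ∀ x y, 0 ≤ b x y)
    (n : X → ℝ)
    (hn : ∀ x, HasSum (b x) (n x))
    (hn_pos : ∀ x, 0 < n x)
    (μ : Measure X)
    (hμ : μ = Measure.sum fun x => ENNReal.ofReal (n x) • Measure.dirac x)
    (L2 : Lp ℂ 2 μ →L[ℂ] Lp ℂ 2 μ)
    (hL2 : ∀ f : Lp ℂ 2 μ, ∀ᵐ x ∂μ,
      (L2 f : X → ℂ) x =
        (n x : ℂ)⁻¹ * ∑' y : X, (b x y : ℂ) * ((f : X → ℂ) x - (f : X → ℂ) y))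
    (c : ℝ)
    (hc : ∀ (W : Finset X) (u : X → ℝ), ∑ x ∈ W, ∑ y ∈ W, b x y * (u x * u y) ≤
      (1 - c) * ∑ x ∈ W, n x * u x ^ 2)
    (f : Lp ℂ 2 μ) :
    c * ‖f‖ ^ 2 ≤ (inner ℂ (L2 f) f).re := by
  let e : X → Lp ℂ 2 μ := fun x =>
    indicatorConstLp 2 (measurableSet_singleton x) (aux_fin n hn_pos μ hμ x) (1 : ℂ)
  have he : ∀ x y, e x y = Set.indicator {x} (fun _ => (1 : ℂ)) y := fun x =>
    aux_ae hn_pos hμ indicatorConstLp_coeFn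
  have hdense : (Submodule.span ℂ (Set.range e)).topologicalClosure = ⊤ := by
    rw [Submodule.topologicalClosure_eq_top_iff, Submodule.eq_bot_iff]
    intro g hg
    apply Lp.ext
    refine Filter.Eventually.of_forall fun x => ?_
    rw [aux_ae hn_pos hμ (Lp.coeFn_zero ℂ 2 μ) x]
    have h1 := (Submodule.mem_orthogonal _ _).1 hg (e x) (Submodule.subset_span ⟨x, rfl⟩)
    have h2 := aux_int hn_pos hμ (MeasureTheory.L2.integrable_inner (𝕜 := ℂ) (e x) g)
    rw [← MeasureTheory.L2.inner_def, h1] at h2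
    have h3 := h2.unique (hasSum_single x (fun y hy => by rw [he]; simp [hy]))
    rw [he] at h3
    simpa [(hn_pos x).ne'] using h3.symm
  have hsupp : ∀ g ∈ Submodule.span ℂ (Set.range e), ∃ W : Finset X, ∀ x, x ∉ W → g x = 0 := by
    intro g hg
    induction hg using Submodule.span_induction with
    | mem g hg =>
      obtain ⟨x, rfl⟩ := hg
      exact ⟨{x}, fun y hy => by rw [he]; exact Set.indicator_of_notMem (by simpa using hy) _⟩
    | zero => exact ⟨∅, fun y _ => aux_ae hn_pos hμ (Lp.coeFn_zero ℂ 2 μ) y⟩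
    | add g h _ _ ihg ihh =>
      obtain ⟨V, hV⟩ := ihg
      obtain ⟨W, hW⟩ := ihh
      refine ⟨V ∪ W, fun y hy => ?_⟩
      rw [Finset.mem_union, not_or] at hy
      rw [aux_ae hn_pos hμ (Lp.coeFn_add g h) y, Pi.add_apply, hV y hy.1, hW y hy.2, add_zero]
    | smul a g _ ihg =>
      obtain ⟨V, hV⟩ := ihg
      refine ⟨V, fun y hy => ?_⟩
      rw [aux_ae hn_pos hμ (Lp.coeFn_smul a g) y, Pi.smul_apply, hV y hy, smul_zero]
  have hclosed : IsClosed {f : Lp ℂ 2 μ | c * ‖f‖ ^ 2 ≤ (inner ℂ (L2 f) f).re} := by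
    apply isClosed_le
    · fun_prop
    · exact Complex.continuous_re.comp (Continuous.inner L2.continuous continuous_id)
  have hsub : (Submodule.span ℂ (Set.range e) : Set (Lp ℂ 2 μ)) ⊆
      {f : Lp ℂ 2 μ | c * ‖f‖ ^ 2 ≤ (inner ℂ (L2 f) f).re} := fun g hg => by
    obtain ⟨W, hW⟩ := hsupp g hg
    exact aux_quad_fin b hb_nonneg n hn hn_pos μ hμ L2 hL2 c hc g W hW
  have hf : f ∈ (Submodule.span ℂ (Set.range e)).topologicalClosure := by rw [hdense]; trivial
  exact closure_minimal hsub hclosed hf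

lemma aux_spec {X : Type*} [Countable X] [MeasurableSpace X] [MeasurableSingletonClass X]
    [DecidableEq X]
    (b : X → X → ℝ)
    (hb_nonneg : ∀ x y, 0 ≤ b x y)
    (n : X → ℝ)
    (hn : ∀ x, HasSum (b x) (n x))
    (hn_pos : ∀ x, 0 < n x)
    (μ : Measure X)
    (hμ : μ = Measure.sum fun x => ENNReal.ofReal (n x) • Measure.dirac x)
    (L2 : Lp ℂ 2 μ →L[ℂ] Lp ℂ 2 μ)
    (hL2 : ∀ f : Lp ℂ 2 μ, ∀ᵐ x ∂μ,
      (L2 f : X → ℂ) x =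
        (n x : ℂ)⁻¹ * ∑' y : X, (b x y : ℂ) * ((f : X → ℂ) x - (f : X → ℂ) y))
    (c : ℝ)
    (hc : ∀ (W : Finset X) (u : X → ℝ), ∑ x ∈ W, ∑ y ∈ W, b x y * (u x * u y) ≤
      (1 - c) * ∑ x ∈ W, n x * u x ^ 2) (z : ℂ) (hz : z ∈ spectrum ℂ L2) : c ≤ z.re := by
  by_contra! hlt
  apply spectrum.mem_iff.1 hz
  rw [← IsUnit.neg_iff, neg_sub]
  refine ContinuousLinearMap.isUnit_of_forall_le_norm_inner_map _ (c := (c - z.re).toNNReal)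
    (by simpa using hlt) fun f => ?_
  have h1 := aux_quad b hb_nonneg n hn hn_pos μ hμ L2 hL2 c hc f
  refine le_trans ?_ (Complex.re_le_norm _)
  have h2 : ((L2 - algebraMap ℂ (Lp ℂ 2 μ →L[ℂ] Lp ℂ 2 μ) z) f) = L2 f - z • f := by
    simp [Algebra.algebraMap_eq_smul_one]
  rw [h2, inner_sub_left, inner_smul_left, Complex.sub_re, inner_self_eq_norm_sq_to_K]
  have h3 : ((starRingEnd ℂ) z * (Complex.ofReal ‖f‖) ^ 2).re = z.re * ‖f‖ ^ 2 := by
    rw [← Complex.ofReal_pow, Complex.re_mul_ofReal, Complex.conj_re]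
  erw [h3]
  rw [Real.coe_toNNReal _ (by linarith)]
  linarith

lemma aux_test {X : Type*} [Countable X] [MeasurableSpace X] [MeasurableSingletonClass X]
    [DecidableEq X]
    (b : X → X → ℝ)
    (hb_symm : ∀ x y, b x y = b y x)
    (hb_nonneg : ∀ x y, 0 ≤ b x y)
    (n : X → ℝ)
    (hn : ∀ x, HasSum (b x) (n x))
    (hn_pos : ∀ x, 0 < n x)
    (μ : Measure X)
    (hμ : μ = Measure.sum fun x => ENNReal.ofReal (n x) • Measure.dirac x)
    (L2 : Lp ℂ 2 μ →L[ℂ] Lp ℂ 2 μ)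
    (hL2 : ∀ f : Lp ℂ 2 μ, ∀ᵐ x ∂μ,
      (L2 f : X → ℂ) x =
        (n x : ℂ)⁻¹ * ∑' y : X, (b x y : ℂ) * ((f : X → ℂ) x - (f : X → ℂ) y))
    (W : Finset X) : ∃ f : Lp ℂ 2 μ, ‖f‖ ^ 2 = ∑ x ∈ W, n x ∧
    ‖L2 f‖ ^ 2 ≤ 2 * (∑ x ∈ W, n x - ∑ x ∈ W, ∑ y ∈ W, b x y) := by
  have hfin : μ (W : Set X) ≠ ∞ := by
    rw [← Set.biUnion_of_singleton (W : Set X)]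
    exact (measure_biUnion_lt_top W.finite_toSet
      fun x _ => (aux_fin n hn_pos μ hμ x).lt_top).ne
  let f : Lp ℂ 2 μ := indicatorConstLp 2 W.measurableSet hfin (1 : ℂ)
  have hf : ∀ x, f x = Set.indicator (W : Set X) (fun _ => (1 : ℂ)) x :=
    aux_ae hn_pos hμ indicatorConstLp_coeFn
  have hW : ∀ x, x ∉ W → f x = 0 := fun x hx => by rw [hf]; simp [hx]
  have hW1 : ∀ x, x ∈ W → f x = 1 := fun x hx => by rw [hf]; simp [hx]
  refine ⟨f, ?_, ?_⟩
  · rw [(aux_norm2 n hn_pos μ hμ f).unique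
      (hasSum_sum_of_ne_finset_zero (s := W) fun y hy => by simp [hW y hy])]
    refine Finset.sum_congr rfl fun x hx => ?_
    simp [hW1 x hx]
  · have h1 := aux_norm2 n hn_pos μ hμ (L2 f)
    have hk : ∀ x, ∑ y ∈ W, b x y ≤ n x := fun x =>
      sum_le_hasSum W (fun y _ => hb_nonneg x y) (hn x)
    have hk0 : ∀ x, 0 ≤ ∑ y ∈ W, b x y := fun x => Finset.sum_nonneg fun y _ => hb_nonneg x y
    have h2 : HasSum (fun x => if x ∈ W then n x - 2 * ∑ y ∈ W, b x y else 0)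
        (∑ x ∈ W, (n x - 2 * ∑ y ∈ W, b x y)) := by
      rw [← Finset.sum_congr rfl fun x hx => if_pos hx]
      exact hasSum_sum_of_ne_finset_zero fun y hy => if_neg hy
    have h3 : HasSum (fun x => ∑ y ∈ W, b x y) (∑ y ∈ W, n y) := by
      refine hasSum_sum fun y _ => ?_
      simp only [fun x => hb_symm x y]
      exact hn y
    have h4 := h2.add h3
    have h5 : ∑ x ∈ W, (n x - 2 * ∑ y ∈ W, b x y) + ∑ y ∈ W, n y =
        2 * (∑ x ∈ W, n x - ∑ x ∈ W, ∑ y ∈ W, b x y) := by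
      rw [Finset.sum_sub_distrib, ← Finset.mul_sum]; ring
    rw [h5] at h4
    refine hasSum_le (fun x => ?_) h1 h4
    have hx : (L2 f) x = ((if x ∈ W then 1 else 0) - (n x)⁻¹ * ∑ y ∈ W, b x y : ℝ) := by
      rw [aux_L2_formula b n hn hn_pos μ hμ L2 hL2 f W hW x, hf]
      have : ∑ y ∈ W, (b x y : ℂ) * f y = ∑ y ∈ W, (b x y : ℂ) :=
        Finset.sum_congr rfl fun y hy => by rw [hW1 y hy, mul_one]
      rw [this]
      by_cases h : x ∈ W <;> simp [h]
    rw [hx, Complex.norm_real, Real.norm_eq_abs, sq_abs]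
    have hp := hn_pos x
    set s := ∑ y ∈ W, b x y
    have hs : (n x)⁻¹ * s ≤ 1 := by
      rw [inv_mul_le_iff₀ hp]; simpa using hk x
    have hs0 : 0 ≤ (n x)⁻¹ * s := mul_nonneg (by positivity) (hk0 x)
    have hs2 : s = n x * ((n x)⁻¹ * s) := by rw [mul_inv_cancel_left₀ hp.ne']
    generalize (n x)⁻¹ * s = t at *
    rw [hs2]
    split_ifs
    · nlinarith [mul_nonneg hp.le (mul_nonneg hs0 (sub_nonneg.2 hs))]
    · nlinarith [mul_nonneg hp.le (mul_nonneg hs0 (sub_nonneg.2 hs))]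



/-- Assume `m = n`. Then `inf{Re z : z ∈ σ(L₁)} = inf{Re z : z ∈ σ(L₂)}`
if and only if the Cheeger constant `α = 0`, where `α` is the maximal `β ≥ 0` such that
`β n(W) ≤ |∂W|` for all finite `W ⊆ X`, with `|∂W| = ∑_{x ∈ W} ∑_{y ∉ W} b(x,y)`.
Here `ℓ^p(X,n)` is realized as `Lp ℂ p μ` for the weighted counting measure
`μ = ∑_x n(x) δ_x`. -/
theorem stmt16 {X : Type*} [Countable X] [MeasurableSpace X] [MeasurableSingletonClass X]
    (b : X → X → ℝ)
    (hb_symm : ∀ x y, b x y = b y x)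
    (hb_diag : ∀ x, b x x = 0)
    (hb_nonneg : ∀ x y, 0 ≤ b x y)
    (n : X → ℝ) (hn : ∀ x, HasSum (b x) (n x)) (hn_pos : ∀ x, 0 < n x)
    (α : ℝ)
    (hα : IsGreatest {β : ℝ | 0 ≤ β ∧ ∀ W : Finset X,
      β * (∑ x ∈ W, n x) ≤ ∑ x ∈ W, ∑' y : {y : X // y ∉ W}, b x y} α)
    (μ : Measure X)
    (hμ : μ = Measure.sum fun x => ENNReal.ofReal (n x) • Measure.dirac x)
    (L1 : Lp ℂ 1 μ →L[ℂ] Lp ℂ 1 μ)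
    (hL1 : ∀ f : Lp ℂ 1 μ, ∀ᵐ x ∂μ,
      (L1 f : X → ℂ) x =
        (n x : ℂ)⁻¹ * ∑' y : X, (b x y : ℂ) * ((f : X → ℂ) x - (f : X → ℂ) y))
    (L2 : Lp ℂ 2 μ →L[ℂ] Lp ℂ 2 μ)
    (hL2 : ∀ f : Lp ℂ 2 μ, ∀ᵐ x ∂μ,
      (L2 f : X → ℂ) x =
        (n x : ℂ)⁻¹ * ∑' y : X, (b x y : ℂ) * ((f : X → ℂ) x - (f : X → ℂ) y)) :
    sInf (Complex.re '' spectrum ℂ L1) = sInf (Complex.re '' spectrum ℂ L2) ↔ α = 0 := by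
  classical
  obtain ⟨⟨hα0, hαW⟩, hmax⟩ := hα
  have hbd : ∀ (W : Finset X), ∑ x ∈ W, ∑' y : {y : X // y ∉ W}, b x y =
      ∑ x ∈ W, n x - ∑ x ∈ W, ∑ y ∈ W, b x y := by
    intro W
    rw [← Finset.sum_sub_distrib]
    refine Finset.sum_congr rfl fun x _ => ?_
    have := (hn x).summable.sum_add_tsum_subtype_compl W
    rw [(hn x).tsum_eq] at this
    linarith
  simp only [hbd] at hαW hmax
  have hbn : ∀ x (W : Finset X), ∑ y ∈ W, b x y ≤ n x := fun x W =>
    sum_le_hasSum W (fun y _ => hb_nonneg x y) (hn x)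
  have hne : Nonempty X := by
    by_contra hne
    rw [not_nonempty_iff] at hne
    have := hmax (show α + 1 ∈ _ from ⟨by linarith, fun W => by simp [Finset.eq_empty_of_isEmpty W]⟩)
    linarith
  obtain ⟨x0⟩ := hne
  have hα1 : α ≤ 1 := by
    have := hαW {x0}
    simp [hb_diag] at this
    nlinarith [hn_pos x0]
  have hc := aux_cheeger b hb_symm hb_nonneg n hbn α hα0 hα1 (fun W => by linarith [hαW W])
  have hspec := aux_spec b hb_nonneg n hn hn_pos μ hμ L2 hL2 (α ^ 2 / 2) hc
  have hnt : Nontrivial (Lp ℂ 2 μ) := by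
    obtain ⟨f, hf, -⟩ := aux_test b hb_symm hb_nonneg n hn hn_pos μ hμ L2 hL2 {x0}
    refine ⟨f, 0, ?_⟩
    rintro rfl
    simp at hf
    exact (hn_pos x0).ne hf
  have hsne : (Complex.re '' spectrum ℂ L2).Nonempty := (spectrum.nonempty L2).image _
  rw [aux_L1 b hb_symm hb_nonneg n hn hn_pos μ hμ x0 L1 hL1]
  have hge : α ^ 2 / 2 ≤ sInf (Complex.re '' spectrum ℂ L2) :=
    le_csInf hsne (by rintro _ ⟨z, hz, rfl⟩; exact hspec z hz)
  constructor
  · intro h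
    rw [← h] at hge
    nlinarith [sq_nonneg α]
  · rintro rfl
    refine le_antisymm (by simpa using hge) ?_
    refine csInf_le ⟨0, by rintro _ ⟨z, hz, rfl⟩; simpa using hspec z hz⟩ ⟨0, ?_, rfl⟩
    rw [spectrum.zero_mem_iff]
    rintro ⟨U, hU⟩
    set K := ‖(↑U⁻¹ : Lp ℂ 2 μ →L[ℂ] Lp ℂ 2 μ)‖ with hK
    have hKb : ∀ f, ‖f‖ ≤ K * ‖L2 f‖ := fun f => by
      have h1 : (↑U⁻¹ : Lp ℂ 2 μ →L[ℂ] Lp ℂ 2 μ) (L2 f) = f := by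
        rw [← hU, ← mul_apply_eq_comp, Units.inv_mul, one_apply_eq_self]
      calc ‖f‖ = ‖(↑U⁻¹ : Lp ℂ 2 μ →L[ℂ] Lp ℂ 2 μ) (L2 f)‖ := by rw [h1]
        _ ≤ _ := ContinuousLinearMap.le_opNorm _ _
    have hpos : 0 < 1 / (2 * K ^ 2 + 1) := by positivity
    have hnot : ¬ (∀ W : Finset X, 1 / (2 * K ^ 2 + 1) * ∑ x ∈ W, n x ≤
        ∑ x ∈ W, n x - ∑ x ∈ W, ∑ y ∈ W, b x y) := fun h =>
      absurd (hmax (show _ ∈ _ from ⟨hpos.le, h⟩)) (not_le.2 hpos)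
    push Not at hnot
    obtain ⟨W, hW⟩ := hnot
    obtain ⟨f, hf1, hf2⟩ := aux_test b hb_symm hb_nonneg n hn hn_pos μ hμ L2 hL2 W
    have h1 : ‖f‖ ^ 2 ≤ (K * ‖L2 f‖) ^ 2 := by gcongr; exact hKb f
    rw [mul_pow, hf1] at h1
    have h2 := mul_le_mul_of_nonneg_left hf2 (sq_nonneg K)
    rw [one_div, lt_inv_mul_iff₀ (by positivity)] at hW
    have h3 : 0 ≤ ∑ x ∈ W, n x - ∑ x ∈ W, ∑ y ∈ W, b x y := by
      simpa using hαW W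
    nlinarith
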